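/- Let ρ(n) denote the number of distinct factors of length n of the infinite word k. Then limsup_{n→∞} ρ(n)/n = (30 + √3)/23 and liminf_{n→∞} ρ(n)/n = (3 + √3)/4. -/

import Mathlib

open Filter

/-- The substitution `h` with `h(1) = 110` and `h(0) = 11`. -/
def hsub : ℕ → List ℕ
  | 0 => [1, 1]
  | 1 => [1, 1, 0]
  | _ => []

/-- `h` extended to words by concatenation. -/
def happ (w : List ℕ) : List ℕ := w.flatMap hsub

/-- `K n = h^n(1)`. -/
def Kword (n : ℕ) : List ℕ := happ^[n] [1]

/-- `w` is a factor of the infinite word `k` (indexed from 1). -/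
def IsFactor (k : ℕ → ℕ) (w : List ℕ) : Prop :=
  ∃ i : ℕ, 1 ≤ i ∧ ∀ j : ℕ, j < w.length → w.getD j 0 = k (i + j)

/-- The subword complexity `ρ(n)`: the number of distinct factors of `k` of length `n`. -/
noncomputable def complexity (k : ℕ → ℕ) (n : ℕ) : ℕ :=
  Set.ncard {w : List ℕ | w.length = n ∧ IsFactor k w}

/-- Binary words. -/
def KBin (w : List ℕ) : Prop := ∀ a ∈ w, a = 0 ∨ a = 1

/-- Factors, in terms of the finite words `Kword m`. -/
def KF (w : List ℕ) : Prop := ∃ m, w <:+: Kword m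

/-- Left special factors. -/
def KLS (v : List ℕ) : Prop := KF (0 :: v) ∧ KF (1 :: v)

theorem take_pfx (n : ℕ) (l : List ℕ) : l.take n <+: l :=
  ⟨l.drop n, List.take_append_drop n l⟩

theorem happ_nil : happ [] = [] := rfl
theorem happ_zero (w : List ℕ) : happ (0 :: w) = 1 :: 1 :: happ w := by simp [happ, hsub]
theorem happ_one (w : List ℕ) : happ (1 :: w) = 1 :: 1 :: 0 :: happ w := by simp [happ, hsub]
theorem happ_append (a b : List ℕ) : happ (a ++ b) = happ a ++ happ b := by simp [happ]

theorem happ_ifx {a b : List ℕ} (h : a <:+: b) : happ a <:+: happ b := by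
  obtain ⟨s, t, rfl⟩ := h
  exact ⟨happ s, happ t, by simp [happ_append]⟩

theorem happ_pfx {a b : List ℕ} (h : a <+: b) : happ a <+: happ b := by
  obtain ⟨t, rfl⟩ := h
  exact ⟨happ t, by simp [happ_append]⟩

theorem Kword_succ (m : ℕ) : Kword (m + 1) = happ (Kword m) := by
  simp [Kword, Function.iterate_succ_apply']

theorem KBin_nil : KBin [] := by simp [KBin]

theorem KBin_cons {a : ℕ} {w : List ℕ} : KBin (a :: w) ↔ (a = 0 ∨ a = 1) ∧ KBin w := by
  simp [KBin]

theorem KBin_append {a b : List ℕ} : KBin (a ++ b) ↔ KBin a ∧ KBin b := by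
  simp only [KBin, List.mem_append]
  constructor
  · intro h
    exact ⟨fun x hx => h x (Or.inl hx), fun x hx => h x (Or.inr hx)⟩
  · rintro ⟨h1, h2⟩ x (hx | hx)
    · exact h1 x hx
    · exact h2 x hx

theorem KBin_happ (w : List ℕ) : KBin w → KBin (happ w) := by
  induction w with
  | nil => intro h; exact h
  | cons a w ih =>
    intro h
    obtain ⟨h1, h2⟩ := KBin_cons.1 h
    rcases h1 with rfl | rfl
    · rw [happ_zero]; simp [KBin_cons, ih h2]
    · rw [happ_one]; simp [KBin_cons, ih h2]

theorem KBin_Kword (m : ℕ) : KBin (Kword m) := by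
  induction m with
  | zero => simp [Kword, KBin]
  | succ m ih => rw [Kword_succ]; exact KBin_happ _ ih

theorem KBin_ifx {a b : List ℕ} (h : a <:+: b) (hb : KBin b) : KBin a :=
  fun x hx => hb x (h.subset hx)

theorem KF_bin {w : List ℕ} (h : KF w) : KBin w := by
  obtain ⟨m, hm⟩ := h
  exact KBin_ifx hm (KBin_Kword m)

theorem KF_ifx {a b : List ℕ} (h : a <:+: b) (hb : KF b) : KF a := by
  obtain ⟨m, hm⟩ := hb
  exact ⟨m, h.trans hm⟩

theorem KF_happ {w : List ℕ} (h : KF w) : KF (happ w) := by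
  obtain ⟨m, hm⟩ := h
  exact ⟨m + 1, by rw [Kword_succ]; exact happ_ifx hm⟩

theorem Kword_succ_eq (m : ℕ) : ∃ t, Kword (m + 1) = Kword m ++ Kword m ++ t := by
  induction m with
  | zero => exact ⟨[0], by simp [Kword, happ, hsub]⟩
  | succ m ih =>
    obtain ⟨t, ht⟩ := ih
    refine ⟨happ t, ?_⟩
    conv_lhs => rw [Kword_succ (m + 1), ht, happ_append, happ_append]
    rw [Kword_succ m]

theorem Kword_head (m : ℕ) : ∃ t, Kword m = 1 :: t := by
  induction m with
  | zero => exact ⟨[], rfl⟩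
  | succ m ih =>
    obtain ⟨t, ht⟩ := ih
    exact ⟨_, by rw [Kword_succ, ht, happ_one]⟩

theorem Kword_prefix_succ (m : ℕ) : Kword m <+: Kword (m + 1) := by
  obtain ⟨t, ht⟩ := Kword_succ_eq m
  exact ⟨Kword m ++ t, by rw [ht]; simp⟩

theorem Kword_pfx {m n : ℕ} (h : m ≤ n) : Kword m <+: Kword n := by
  induction n, h using Nat.le_induction with
  | base => exact List.prefix_refl _
  | succ n _ ih => exact ih.trans (Kword_prefix_succ n)

theorem Kword_length (m : ℕ) : m < (Kword m).length := by
  induction m with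
  | zero => simp [Kword]
  | succ m ih =>
    obtain ⟨t, ht⟩ := Kword_succ_eq m
    rw [ht]; simp; omega

/-- right extension -/
theorem KF_right {w : List ℕ} (h : KF w) : ∃ a, (a = 0 ∨ a = 1) ∧ KF (w ++ [a]) := by
  obtain ⟨m, s, t, h⟩ := h
  obtain ⟨r, hr⟩ := Kword_succ_eq m
  obtain ⟨q, hq⟩ := Kword_head m
  obtain ⟨a, t', ht'⟩ : ∃ a t', t ++ Kword m ++ r = a :: t' := by
    cases t with
    | nil => exact ⟨1, q ++ r, by simp [hq]⟩
    | cons a t => exact ⟨a, _, rfl⟩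
  have hF : KF (w ++ [a]) := by
    refine ⟨m + 1, s, t', ?_⟩
    rw [hr]
    nth_rewrite 1 [← h]
    have : s ++ w ++ t ++ Kword m ++ r = s ++ w ++ (t ++ Kword m ++ r) := by simp
    rw [this, ht']; simp
  exact ⟨a, KF_bin hF a (by simp), hF⟩

/-- left extension -/
theorem KF_left {w : List ℕ} (h : KF w) : ∃ a, (a = 0 ∨ a = 1) ∧ KF (a :: w) := by
  obtain ⟨m, s, t, h⟩ := h
  obtain ⟨r, hr⟩ := Kword_succ_eq m
  obtain ⟨q, hq⟩ := Kword_head m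
  have hne : Kword m ++ s ≠ [] := by simp [hq]
  obtain ⟨s', a, hs⟩ : ∃ s' a, Kword m ++ s = s' ++ [a] :=
    ⟨_, _, (List.dropLast_append_getLast hne).symm⟩
  have hF : KF (a :: w) := by
    refine ⟨m + 1, s', t ++ r, ?_⟩
    rw [hr]
    nth_rewrite 2 [← h]
    have : Kword m ++ (s ++ w ++ t) ++ r = (Kword m ++ s) ++ w ++ t ++ r := by simp
    rw [this, hs]; simp
  exact ⟨a, KF_bin hF a (by simp), hF⟩

theorem happ_split_zero (y : List ℕ) : KBin y → ∀ s r, happ y = s ++ 0 :: r →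
    ∃ y1 y2, y = y1 ++ 1 :: y2 ∧ s = happ y1 ++ [1, 1] ∧ r = happ y2 := by
  induction y with
  | nil => intro _ s r h; simp [happ_nil] at h
  | cons a y ih =>
    intro hy s r h
    obtain ⟨ha, hy'⟩ := KBin_cons.1 hy
    rcases ha with rfl | rfl
    · rw [happ_zero] at h
      rcases s with _ | ⟨b, _ | ⟨c, s⟩⟩
      · simp at h
      · simp at h
      · simp at h
        obtain ⟨rfl, rfl, h⟩ := h
        obtain ⟨y1, y2, rfl, rfl, rfl⟩ := ih hy' _ _ h
        exact ⟨0 :: y1, y2, rfl, by simp [happ_zero], rfl⟩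
    · rw [happ_one] at h
      rcases s with _ | ⟨b, _ | ⟨c, _ | ⟨d, s⟩⟩⟩
      · simp at h
      · simp at h
      · simp at h
        obtain ⟨rfl, rfl, rfl⟩ := h
        exact ⟨[], y, rfl, by simp [happ_nil], rfl⟩
      · simp at h
        obtain ⟨rfl, rfl, rfl, h⟩ := h
        obtain ⟨y1, y2, rfl, rfl, rfl⟩ := ih hy' _ _ h
        exact ⟨1 :: y1, y2, rfl, by simp [happ_one], rfl⟩

theorem KF_pre {w : List ℕ} (h : KF w) : ∃ m s t, s ++ w ++ t = happ (Kword m) := by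
  obtain ⟨m, hm⟩ := h
  obtain ⟨s, t, h⟩ := hm.trans (Kword_prefix_succ m).isInfix
  exact ⟨m, s, t, by rw [h, Kword_succ]⟩

theorem KF_zero {v : List ℕ} (h : KF (0 :: v)) : ∃ y, KF (1 :: y) ∧ v <+: happ y := by
  obtain ⟨m, s, t, h⟩ := KF_pre h
  obtain ⟨y1, y2, h1, h2, h3⟩ := happ_split_zero _ (KBin_Kword m) s (v ++ t) (by simpa using h.symm)
  exact ⟨y2, ⟨m, y1, [], by simp [h1]⟩, ⟨t, h3⟩⟩

theorem KF_one {v : List ℕ} (h : KF (1 :: 1 :: 1 :: 0 :: v)) :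
    ∃ y, KF (0 :: 1 :: y) ∧ v <+: happ y := by
  obtain ⟨m, s, t, h⟩ := KF_pre h
  obtain ⟨y1, y2, h1, h2, h3⟩ := happ_split_zero _ (KBin_Kword m) (s ++ [1, 1, 1]) (v ++ t)
    (by simpa using h.symm)
  have h4 : s ++ [1] = happ y1 := by
    have : (s ++ [1]) ++ [1, 1] = happ y1 ++ [1, 1] := by rw [← h2]; simp
    exact List.append_cancel_right this
  have hb : KBin y1 := by
    have := KBin_Kword m
    rw [h1] at this
    exact (KBin_append.1 this).1
  obtain ⟨z, rfl⟩ : ∃ z, y1 = z ++ [0] := by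
    rcases List.eq_nil_or_concat y1 with rfl | ⟨z, a, rfl⟩
    · simp [happ_nil] at h4
    · have ha : a = 0 ∨ a = 1 := hb a (by simp)
      rcases ha with rfl | rfl
      · exact ⟨z, by simp⟩
      · exfalso
        have h5 : s ++ [1] = (happ z ++ [1, 1]) ++ [0] := by
          rw [h4]; simp [happ_append, happ_one, happ_nil]
        have := (List.append_inj' h5 rfl).2
        simp at this
  exact ⟨y2, ⟨m, z, [], by simp [h1]⟩, ⟨t, h3⟩⟩

theorem happ_start {y : List ℕ} (hy : KBin y) : [1, 1] <+: happ y ++ [1, 1] := by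
  cases y with
  | nil => simp [happ_nil]
  | cons a y =>
    rcases (KBin_cons.1 hy).1 with rfl | rfl
    · simp [happ_zero]
    · simp [happ_one]

theorem happ_prefix_cases {v y : List ℕ} {a : ℕ} (hy : KBin y) (h : a :: v <+: happ y) :
    a = 1 ∧ ((∃ z, y = 0 :: z ∧ v <+: 1 :: happ z) ∨
      (∃ z, y = 1 :: z ∧ v <+: 1 :: 0 :: happ z)) := by
  cases y with
  | nil => simp [happ_nil] at h
  | cons b y =>
    rcases (KBin_cons.1 hy).1 with rfl | rfl
    · rw [happ_zero, List.cons_prefix_cons] at h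
      exact ⟨h.1, Or.inl ⟨y, rfl, h.2⟩⟩
    · rw [happ_one, List.cons_prefix_cons] at h
      exact ⟨h.1, Or.inr ⟨y, rfl, h.2⟩⟩

theorem not_KF_00 (v : List ℕ) : ¬ KF (0 :: 0 :: v) := by
  intro h
  obtain ⟨y, hy, hv⟩ := KF_zero h
  have := (happ_prefix_cases (KBin_cons.1 (KF_bin hy)).2 hv).1
  omega

theorem not_KF_010 (v : List ℕ) : ¬ KF (0 :: 1 :: 0 :: v) := by
  intro h
  obtain ⟨y, hy, hv⟩ := KF_zero h
  rcases (happ_prefix_cases (KBin_cons.1 (KF_bin hy)).2 hv).2 with ⟨z, _, hz⟩ | ⟨z, _, hz⟩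
  · simp at hz
  · simp at hz

theorem not_KF_01110 (v : List ℕ) : ¬ KF (0 :: 1 :: 1 :: 1 :: 0 :: v) := by
  intro h
  obtain ⟨y, hy, hv⟩ := KF_zero h
  have hb := (KBin_cons.1 (KF_bin hy)).2
  rcases (happ_prefix_cases hb hv).2 with ⟨z, rfl, hz⟩ | ⟨z, _, hz⟩
  · rw [List.cons_prefix_cons] at hz
    rcases (happ_prefix_cases (KBin_cons.1 hb).2 hz.2).2 with ⟨z, _, hz⟩ | ⟨z, _, hz⟩
    · simp at hz
    · simp at hz
  · simp at hz

theorem five_ones (y : List ℕ) : KBin y → [1, 1, 1, 1, 1] <:+: happ y → [0, 0] <:+: y := by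
  induction y with
  | nil => intro _ h; simp [happ_nil] at h
  | cons a y ih =>
    intro hy h
    obtain ⟨ha, hy'⟩ := KBin_cons.1 hy
    rcases ha with rfl | rfl
    · rw [happ_zero, List.infix_cons_iff, List.infix_cons_iff] at h
      have key : [1, 1, 1] <+: happ y → [0, 0] <:+: 0 :: y := by
        intro h
        rcases (happ_prefix_cases hy' h).2 with ⟨z, rfl, hz⟩ | ⟨z, _, hz⟩
        · exact ⟨[], z, rfl⟩
        · simp at hz
      rcases h with h | h | h
      · simp only [List.cons_prefix_cons, true_and] at h
        exact key h
      · simp only [List.cons_prefix_cons, true_and] at h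
        exact key (List.IsPrefix.trans ⟨[1], rfl⟩ h)
      · exact (ih hy' h).trans (List.suffix_cons 0 y).isInfix
    · rw [happ_one, List.infix_cons_iff, List.infix_cons_iff, List.infix_cons_iff] at h
      rcases h with h | h | h | h
      · simp at h
      · simp at h
      · simp at h
      · exact (ih hy' h).trans (List.suffix_cons 1 y).isInfix

theorem not_KF_11111 (v : List ℕ) : ¬ KF (1 :: 1 :: 1 :: 1 :: 1 :: v) := by
  intro h
  have h := KF_ifx (a := [1, 1, 1, 1, 1]) ⟨[], v, rfl⟩ h
  obtain ⟨m, s, t, h⟩ := KF_pre h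
  exact not_KF_00 [] ⟨m, five_ones _ (KBin_Kword m) ⟨s, t, h⟩⟩

theorem KLS_pfx {a b : List ℕ} (h : a <+: b) (hb : KLS b) : KLS a :=
  ⟨KF_ifx ((List.prefix_cons_inj 0).2 h).isInfix hb.1,
    KF_ifx ((List.prefix_cons_inj 1).2 h).isInfix hb.2⟩

theorem KLS_bin {v : List ℕ} (h : KLS v) : KBin v := (KBin_cons.1 (KF_bin h.1)).2

theorem KLS_cases {v : List ℕ} (h : KLS v) :
    v <+: [1, 1] ∨ v = [1, 1, 1] ∨ ∃ v', v = 1 :: 1 :: 0 :: v' := by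
  have hb := KLS_bin h
  rcases v with _ | ⟨a, v⟩
  · simp
  rcases (KBin_cons.1 hb).1 with rfl | rfl
  · exact absurd h.1 (not_KF_00 _)
  replace hb := (KBin_cons.1 hb).2
  rcases v with _ | ⟨a, v⟩
  · simp
  rcases (KBin_cons.1 hb).1 with rfl | rfl
  · exact absurd h.1 (not_KF_010 _)
  replace hb := (KBin_cons.1 hb).2
  rcases v with _ | ⟨a, v⟩
  · simp
  rcases (KBin_cons.1 hb).1 with rfl | rfl
  · right; right; exact ⟨v, rfl⟩
  replace hb := (KBin_cons.1 hb).2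
  rcases v with _ | ⟨a, v⟩
  · simp
  rcases (KBin_cons.1 hb).1 with rfl | rfl
  · exact absurd h.1 (not_KF_01110 _)
  · exact absurd h.2 (not_KF_11111 _)

theorem common_pfx (y : List ℕ) : ∀ z v, KBin y → KBin z → v <+: happ y → v <+: happ z →
    ∃ x, x <+: y ∧ x <+: z ∧ v <+: happ x ++ [1, 1] ∧ 2 * x.length ≤ v.length := by
  induction y with
  | nil =>
    intro z v _ _ h _
    exact ⟨[], by simp, by simp, h.trans (by simp [happ_nil]), by simp⟩
  | cons b y ih =>
    intro z v hy hz h1 h2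
    by_cases hv : v <+: [1, 1]
    · exact ⟨[], by simp, by simp, by simpa [happ_nil] using hv, by simp⟩
    rcases v with _ | ⟨v1, _ | ⟨v2, _ | ⟨v3, v⟩⟩⟩
    · simp at hv
    · exact absurd (by simp [(happ_prefix_cases hy h1).1]) hv
    · exfalso; apply hv
      rcases (happ_prefix_cases hy h1) with ⟨rfl, ⟨q, _, hq⟩ | ⟨q, _, hq⟩⟩ <;> simp_all
    rcases (happ_prefix_cases hy h1) with ⟨rfl, ⟨q, hq0, hq⟩ | ⟨q, hq0, hq⟩⟩
    · obtain ⟨rfl, rfl⟩ := List.cons.inj hq0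
      rw [List.cons_prefix_cons] at hq
      obtain ⟨rfl, hq⟩ := hq
      have hv3 := (happ_prefix_cases (KBin_cons.1 hy).2 hq).1
      subst hv3
      rcases (happ_prefix_cases hz h2) with ⟨_, ⟨r, rfl, hr⟩ | ⟨r, _, hr⟩⟩
      · rw [List.cons_prefix_cons] at hr
        obtain ⟨x, hx1, hx2, hx3, hx4⟩ := ih r _ (KBin_cons.1 hy).2 (KBin_cons.1 hz).2 hq hr.2
        refine ⟨0 :: x, by simpa using hx1, by simpa using hx2, ?_, ?_⟩
        · rw [happ_zero]; simpa using hx3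
        · simp at hx4 ⊢; omega
      · simp at hr
    · obtain ⟨rfl, rfl⟩ := List.cons.inj hq0
      rw [List.cons_prefix_cons, List.cons_prefix_cons] at hq
      obtain ⟨rfl, rfl, hq⟩ := hq
      rcases (happ_prefix_cases hz h2) with ⟨_, ⟨r, rfl, hr⟩ | ⟨r, rfl, hr⟩⟩
      · rw [List.cons_prefix_cons] at hr
        have := (happ_prefix_cases (KBin_cons.1 hz).2 hr.2).1
        omega
      · rw [List.cons_prefix_cons, List.cons_prefix_cons] at hr
        obtain ⟨x, hx1, hx2, hx3, hx4⟩ := ih r _ (KBin_cons.1 hy).2 (KBin_cons.1 hz).2 hq hr.2.2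
        refine ⟨1 :: x, by simpa using hx1, by simpa using hx2, ?_, ?_⟩
        · rw [happ_one]; simpa using hx3
        · simp at hx4 ⊢; omega

theorem KLS_desub {v : List ℕ} (h : KLS (1 :: 1 :: 0 :: v)) :
    ∃ x, KLS x ∧ (1 :: 1 :: 0 :: v) <+: happ x ++ [1, 1] ∧ x.length ≤ v.length + 2 := by
  obtain ⟨y, hy, hvy⟩ := KF_zero h.1
  obtain ⟨z, hz, hvz⟩ := KF_one h.2
  have hvz' : (1 :: 1 :: 0 :: v) <+: happ (1 :: z) := by rw [happ_one]; simpa using hvz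
  obtain ⟨x, hx1, hx2, hx3, hx4⟩ := common_pfx y (1 :: z) _ (KBin_cons.1 (KF_bin hy)).2
    (KBin_cons.1 (KF_bin hz)).2 hvy hvz'
  refine ⟨x, ⟨KF_ifx ((List.prefix_cons_inj 0).2 hx2).isInfix hz,
    KF_ifx ((List.prefix_cons_inj 1).2 hx1).isInfix hy⟩, hx3, ?_⟩
  simp at hx4; omega

theorem KLS_sub {x : List ℕ} (h : KLS x) : KLS (happ x ++ [1, 1]) := by
  constructor
  · obtain ⟨a, ha, h⟩ := KF_right h.2
    have := KF_happ h
    refine KF_ifx ?_ this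
    rcases ha with rfl | rfl
    · exact ⟨[1, 1], [], by simp [happ_append, happ_one, happ_zero, happ_nil]⟩
    · exact ⟨[1, 1], [0], by simp [happ_append, happ_one, happ_nil]⟩
  · obtain ⟨a, ha, h⟩ := KF_right h.1
    have := KF_happ h
    refine KF_ifx ?_ this
    rcases ha with rfl | rfl
    · exact ⟨[1], [], by simp [happ_append, happ_zero, happ_nil]⟩
    · exact ⟨[1], [0], by simp [happ_append, happ_one, happ_zero, happ_nil]⟩

/-- strong bispecial words -/
def Kw : ℕ → List ℕ
  | 0 => [1, 1]
  | m + 1 => happ (Kw m) ++ [1, 1]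

/-- weak bispecial words -/
def Ku : ℕ → List ℕ
  | 0 => [1, 1, 1]
  | m + 1 => happ (Ku m) ++ [1, 1]

theorem KBin_Ku (m : ℕ) : KBin (Ku m) := by
  induction m with
  | zero => simp [Ku, KBin]
  | succ m ih => rw [Ku, KBin_append]; exact ⟨KBin_happ _ ih, by simp [KBin]⟩

theorem KBin_Kw (m : ℕ) : KBin (Kw m) := by
  induction m with
  | zero => simp [Kw, KBin]
  | succ m ih => rw [Kw, KBin_append]; exact ⟨KBin_happ _ ih, by simp [KBin]⟩

theorem KLS_class : ∀ (n : ℕ) (v : List ℕ), v.length = n → KLS v →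
    (∃ m, v <+: Kword m) ∨ (∃ m, v <+: Ku m) := by
  intro n
  induction n using Nat.strong_induction_on with
  | _ n ih =>
    intro v hn hv
    rcases KLS_cases hv with h | rfl | ⟨v', rfl⟩
    · exact Or.inl ⟨1, h.trans ⟨[0], by simp [Kword, happ, hsub]⟩⟩
    · exact Or.inr ⟨0, by simp [Ku]⟩
    · obtain ⟨x, hx, h1, h2⟩ := KLS_desub hv
      simp at hn
      rcases ih x.length (by omega) x rfl hx with ⟨m, t, hm⟩ | ⟨m, t, hm⟩
      · left
        refine ⟨m + 2, h1.trans ?_⟩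
        obtain ⟨r, hr⟩ := Kword_succ_eq m
        obtain ⟨q, hq⟩ := Kword_head m
        have hb := KBin_Kword m
        rw [← hm] at hb
        rw [Kword_succ, hr, ← hm]
        rw [hm]
        nth_rewrite 2 [hq]
        rw [← hm]
        simp only [happ_append, happ_one, List.append_assoc]
        rw [List.prefix_append_right_inj]
        refine (happ_start (KBin_append.1 hb).2).trans ?_
        simp
      · right
        refine ⟨m + 1, h1.trans ?_⟩
        have hb := KBin_Ku m
        rw [← hm] at hb
        rw [Ku, ← hm]
        simp only [happ_append, List.append_assoc]
        rw [List.prefix_append_right_inj]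
        exact happ_start (KBin_append.1 hb).2

theorem KLS_Kword (m : ℕ) : KLS (Kword m) := by
  induction m with
  | zero =>
    exact ⟨⟨2, by decide⟩, ⟨2, by decide⟩⟩
  | succ m ih =>
    rw [Kword_succ]
    exact KLS_pfx ⟨[1, 1], rfl⟩ (KLS_sub ih)

theorem KLS_Ku (m : ℕ) : KLS (Ku m) := by
  induction m with
  | zero => exact ⟨⟨3, by decide⟩, ⟨3, by decide⟩⟩
  | succ m ih => exact KLS_sub ih

/-- prefix of length n -/
def KP (n : ℕ) : List ℕ := (Kword n).take n

theorem KP_length (n : ℕ) : (KP n).length = n := by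
  have := Kword_length n
  simp [KP]; omega

theorem prefix_KP {v : List ℕ} {m : ℕ} (h : v <+: Kword m) : v = KP v.length := by
  have h1 : v <+: Kword (max m v.length) := h.trans (Kword_pfx (le_max_left _ _))
  have h2 : KP v.length <+: Kword (max m v.length) :=
    (take_pfx _ _).trans (Kword_pfx (le_max_right _ _))
  exact (List.prefix_of_prefix_length_le h1 h2 (by rw [KP_length])).eq_of_length
    (by rw [KP_length])

theorem KLS_KP (n : ℕ) : KLS (KP n) := KLS_pfx (take_pfx _ _) (KLS_Kword n)

theorem diverge (m : ℕ) :
    (∃ M s t, Ku m = Kw m ++ 1 :: s ∧ Kword M = Kw m ++ 0 :: 1 :: t) ∨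
    (∃ M s t, Ku m = Kw m ++ 0 :: s ∧ Kword M = Kw m ++ 1 :: t) := by
  induction m with
  | zero =>
    left
    exact ⟨2, [], [1, 0, 1, 1], by decide, by decide⟩
  | succ m ih =>
    rcases ih with ⟨M, s, t, h1, h2⟩ | ⟨M, s, t, h1, h2⟩
    · right
      refine ⟨M + 1, happ s ++ [1, 1], 1 :: 0 :: happ t, ?_, ?_⟩
      · rw [Ku, Kw, h1]; simp [happ_append, happ_one]
      · rw [Kword_succ, h2, Kw]; simp [happ_append, happ_one, happ_zero]
    · left
      have hb := KBin_Ku m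
      rw [h1] at hb
      obtain ⟨q, hq⟩ := happ_start (KBin_cons.1 (KBin_append.1 hb).2).2
      have hb' := KBin_Kword M
      rw [h2] at hb'
      obtain ⟨p, hp⟩ := happ_start (KBin_cons.1 (KBin_append.1 hb').2).2
      obtain ⟨r, hr⟩ := Kword_succ_eq M
      obtain ⟨k, hk⟩ := Kword_head M
      refine ⟨M + 2, 1 :: q, 1 :: (p ++ 0 :: happ (k ++ r)), ?_, ?_⟩
      · rw [Ku, Kw, h1]
        simp only [happ_append, happ_zero, List.append_assoc, List.cons_append]
        rw [← hq]; simp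
      · have : Kword (M + 1) = Kw m ++ 1 :: t ++ 1 :: (k ++ r) := by
          rw [hr, ← h2]; nth_rewrite 2 [hk]; simp
        rw [Kword_succ, this, Kw]
        have e : happ (Kw m ++ 1 :: t ++ 1 :: (k ++ r))
            = happ (Kw m) ++ 1 :: 1 :: 0 :: ((happ t ++ [1, 1]) ++ 0 :: happ (k ++ r)) := by
          simp [happ_append, happ_one]
        rw [e, ← hp]; simp

theorem isFactor_iff (k : ℕ → ℕ)
    (hk : ∀ (m i : ℕ), i < (Kword m).length → k (i + 1) = (Kword m).getD i 0) (w : List ℕ) :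
    IsFactor k w ↔ KF w := by
  constructor
  · rintro ⟨i, hi, h⟩
    refine ⟨i + w.length, ?_⟩
    have hl := Kword_length (i + w.length)
    have : w = ((Kword (i + w.length)).drop (i - 1)).take w.length := by
      apply List.ext_getElem
      · simp; omega
      · intro j h1 h2
        have h3 := h j h1
        have e : i + j = (i - 1 + j) + 1 := by omega
        have h4 : i - 1 + j < (Kword (i + w.length)).length := by omega
        rw [e, hk (i + w.length) (i - 1 + j) h4, List.getD_eq_getElem _ _ h1,
          List.getD_eq_getElem _ _ h4] at h3
        simpa using h3
    have h5 : ((Kword (i + w.length)).drop (i - 1)).take w.length <:+: Kword (i + w.length) :=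
      (take_pfx _ _).isInfix.trans (List.drop_suffix _ _).isInfix
    rw [← this] at h5
    exact h5
  · rintro ⟨m, s, t, h⟩
    refine ⟨s.length + 1, by omega, ?_⟩
    intro j hj
    have hl : s.length + j < (Kword m).length := by rw [← h]; simp; omega
    have e : s.length + 1 + j = (s.length + j) + 1 := by omega
    rw [e, hk m _ hl, ← h, List.append_assoc, List.getD_append_right _ _ _ _ (by omega),
      List.getD_append _ _ _ _ (by omega)]
    simp

/-- factors of length n -/
def KFS (n : ℕ) : Set (List ℕ) := {w | w.length = n ∧ KF w}

/-- factors of length n that extend to the left by a -/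
def KFA (a n : ℕ) : Set (List ℕ) := {w | w.length = n ∧ KF (a :: w)}

theorem KFA_sub (a n : ℕ) : KFA a n ⊆ KFS n :=
  fun w hw => ⟨hw.1, KF_ifx (List.suffix_cons a w).isInfix hw.2⟩

theorem KFS_succ (n : ℕ) :
    KFS (n + 1) = (fun w => 0 :: w) '' KFA 0 n ∪ (fun w => 1 :: w) '' KFA 1 n := by
  ext w
  constructor
  · rintro ⟨h1, h2⟩
    rcases w with _ | ⟨a, w⟩
    · simp at h1
    · rcases (KBin_cons.1 (KF_bin h2)).1 with rfl | rfl
      · left; exact ⟨w, ⟨by simpa using h1, h2⟩, rfl⟩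
      · right; exact ⟨w, ⟨by simpa using h1, h2⟩, rfl⟩
  · rintro (⟨v, ⟨h1, h2⟩, rfl⟩ | ⟨v, ⟨h1, h2⟩, rfl⟩)
    · exact ⟨by simp [h1], h2⟩
    · exact ⟨by simp [h1], h2⟩

theorem KFS_finite (n : ℕ) : (KFS n).Finite := by
  induction n with
  | zero =>
    refine (Set.finite_singleton ([] : List ℕ)).subset ?_
    rintro w ⟨h, _⟩
    simpa using h
  | succ n ih =>
    rw [KFS_succ]
    exact ((ih.subset (KFA_sub 0 n)).image _).union ((ih.subset (KFA_sub 1 n)).image _)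

theorem KFS_union (n : ℕ) : KFA 0 n ∪ KFA 1 n = KFS n := by
  apply Set.Subset.antisymm
  · exact Set.union_subset (KFA_sub 0 n) (KFA_sub 1 n)
  · rintro w ⟨h1, h2⟩
    obtain ⟨a, rfl | rfl, h⟩ := KF_left h2
    · left; exact ⟨h1, h⟩
    · right; exact ⟨h1, h⟩

/-- left special factors of length n -/
def KLSn (n : ℕ) : Set (List ℕ) := {w | w.length = n ∧ KLS w}

theorem KFS_inter (n : ℕ) : KFA 0 n ∩ KFA 1 n = KLSn n := by
  ext w
  simp only [KFA, KLSn, KLS, Set.mem_inter_iff, Set.mem_ofPred_eq]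
  tauto

theorem ncard_succ (n : ℕ) : (KFS (n + 1)).ncard = (KFS n).ncard + (KLSn n).ncard := by
  have f0 := (KFS_finite n).subset (KFA_sub 0 n)
  have f1 := (KFS_finite n).subset (KFA_sub 1 n)
  have inj : ∀ a : ℕ, Function.Injective (fun w : List ℕ => a :: w) :=
    fun a x y h => (List.cons.inj h).2
  rw [KFS_succ, Set.ncard_union_eq ?_ (f0.image _) (f1.image _), Set.ncard_image_of_injective _ (inj 0),
    Set.ncard_image_of_injective _ (inj 1), ← KFS_union, ← KFS_inter,
    Set.ncard_union_add_ncard_inter _ _ f0 f1]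
  rw [Set.disjoint_left]
  rintro w ⟨v, _, rfl⟩ ⟨v', _, h⟩
  simp at h

/-- the length sequence -/
def KS : ℕ → ℕ
  | 0 => 0
  | 1 => 1
  | m + 2 => 2 * KS (m + 1) + 2 * KS m + 2

theorem happ_length (w : List ℕ) : KBin w → (happ w).length = 2 * w.length + w.count 1 := by
  induction w with
  | nil => intro _; rfl
  | cons a w ih =>
    intro h
    obtain ⟨h1, h2⟩ := KBin_cons.1 h
    have := ih h2
    rcases h1 with rfl | rfl
    · rw [happ_zero]; simp; omega
    · rw [happ_one]; simp; omega

theorem happ_count (w : List ℕ) : KBin w → (happ w).count 1 = 2 * w.length := by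
  induction w with
  | nil => intro _; rfl
  | cons a w ih =>
    intro h
    obtain ⟨h1, h2⟩ := KBin_cons.1 h
    have := ih h2
    rcases h1 with rfl | rfl
    · rw [happ_zero]; simp; omega
    · rw [happ_one]; simp; omega

theorem Kw_length (m : ℕ) : (Kw m).length = 2 * KS (m + 1) ∧ (Kw m).count 1 = 4 * KS m + 2 := by
  induction m with
  | zero => decide
  | succ m ih =>
    have h1 := happ_length _ (KBin_Kw m)
    have h2 := happ_count _ (KBin_Kw m)
    simp only [Kw, KS, List.length_append, List.count_append]
    simp
    omega

theorem Ku_length (m : ℕ) : (Ku m).length + KS m = 3 * KS (m + 1) ∧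
    (Ku m).count 1 + KS (m + 1) = 8 * KS m + 4 := by
  induction m with
  | zero => decide
  | succ m ih =>
    have h1 := happ_length _ (KBin_Ku m)
    have h2 := happ_count _ (KBin_Ku m)
    simp only [Ku, KS, List.length_append, List.count_append]
    simp
    omega

theorem KS_lt (m : ℕ) : KS m < KS (m + 1) := by
  cases m with
  | zero => decide
  | succ m => simp only [KS]; omega

theorem KS_mono {m n : ℕ} (h : m ≤ n) : KS m ≤ KS n :=
  (strictMono_nat_of_lt_succ KS_lt).monotone h

theorem KS_ge (m : ℕ) : m ≤ KS m := (strictMono_nat_of_lt_succ KS_lt).id_le m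

theorem Ku_take_le {m n : ℕ} (h : n ≤ (Kw m).length) : (Ku m).take n = KP n := by
  have h0 : ∃ s, Ku m = Kw m ++ s := by
    rcases diverge m with ⟨M, s, t, h1, h2⟩ | ⟨M, s, t, h1, h2⟩
    · exact ⟨_, h1⟩
    · exact ⟨_, h1⟩
  have h1 : ∃ M, Kw m <+: Kword M := by
    rcases diverge m with ⟨M, s, t, h1, h2⟩ | ⟨M, s, t, h1, h2⟩
    · exact ⟨M, _, h2.symm⟩
    · exact ⟨M, _, h2.symm⟩
  obtain ⟨s, hs⟩ := h0
  obtain ⟨M, hM⟩ := h1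
  have h2 : (Ku m).take n = (Kw m).take n := by rw [hs, List.take_append_of_le_length h]
  have h3 : (Ku m).take n <+: Kword M := by rw [h2]; exact (take_pfx _ _).trans hM
  have h4 := prefix_KP h3
  rw [h2] at h4 ⊢
  rw [List.length_take, min_eq_left h] at h4
  exact h4

theorem Ku_take_gt {m n : ℕ} (h : (Kw m).length < n) :
    (Ku m).take n ≠ KP n := by
  intro heq
  have hl := (Kw m).length
  have key : ∀ (M a b : ℕ) (s t : List ℕ), a ≠ b → Ku m = Kw m ++ a :: s →
      Kword M = Kw m ++ b :: t → False := by
    intro M a b s t hab h1 h2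
    have h3 : Kw m ++ [a] <+: KP n := by
      rw [← heq, List.prefix_take_iff]
      exact ⟨⟨s, by simp [h1]⟩, by simp; omega⟩
    have h4 : Kw m ++ [a] <+: Kword (max n M) :=
      (h3.trans (take_pfx _ _)).trans (Kword_pfx (le_max_left _ _))
    have h5 : Kw m ++ [b] <+: Kword (max n M) :=
      List.IsPrefix.trans ⟨t, by simp [h2]⟩ (Kword_pfx (le_max_right n M))
    have h6 := (List.prefix_of_prefix_length_le h4 h5 (by simp)).eq_of_length (by simp)
    simp at h6
    exact hab h6
  rcases diverge m with ⟨M, s, t, h1, h2⟩ | ⟨M, s, t, h1, h2⟩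
  · exact key M 1 0 s _ (by decide) h1 h2
  · exact key M 0 1 s _ (by decide) h1 h2

theorem KLSn_one {n : ℕ} (h : ∀ m, n ≤ (Ku m).length → n ≤ (Kw m).length) :
    (KLSn n).ncard = 1 := by
  rw [Set.ncard_eq_one]
  refine ⟨KP n, Set.Subset.antisymm ?_ ?_⟩
  · rintro v ⟨hn, hv⟩
    rw [Set.mem_singleton_iff]
    rcases KLS_class n v hn hv with ⟨m, hm⟩ | ⟨m, hm⟩
    · rw [prefix_KP hm, hn]
    · have h1 := hm.length_le
      rw [hn] at h1
      rw [← Ku_take_le (h m h1), ← hn]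
      exact List.prefix_iff_eq_take.1 hm
  · rintro v rfl
    exact ⟨KP_length n, KLS_KP n⟩

theorem KLSn_two {n m : ℕ} (h1 : (Kw m).length < n) (h2 : n ≤ (Ku m).length) :
    (KLSn n).ncard = 2 := by
  rw [Set.ncard_eq_two]
  refine ⟨(Ku m).take n, KP n, Ku_take_gt h1, Set.Subset.antisymm ?_ ?_⟩
  · rintro v ⟨hn, hv⟩
    rw [Set.mem_insert_iff, Set.mem_singleton_iff]
    rcases KLS_class n v hn hv with ⟨p, hp⟩ | ⟨p, hp⟩
    · right; rw [prefix_KP hp, hn]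
    · have h3 := hp.length_le
      rw [hn] at h3
      have h4 := List.prefix_iff_eq_take.1 hp
      rw [hn] at h4
      by_cases h5 : n ≤ (Kw p).length
      · right; rw [h4, Ku_take_le h5]
      · left
        have a1 := (Kw_length p).1
        have a2 := (Ku_length p).1
        have a3 := (Kw_length m).1
        have a4 := (Ku_length m).1
        have : p = m := by
          rcases lt_trichotomy p m with h | h | h
          · have := KS_mono (show p + 2 ≤ m + 1 by omega)
            simp only [KS] at this
            omega
          · exact h
          · have := KS_mono (show m + 2 ≤ p + 1 by omega)
            simp only [KS] at this
            omega
        rw [h4, this]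
  · rintro v (rfl | rfl)
    · exact ⟨by simp; omega, KLS_pfx (take_pfx _ _) (KLS_Ku m)⟩
    · exact ⟨KP_length n, KLS_KP n⟩

theorem rho_zero : (KFS 0).ncard = 1 := by
  rw [Set.ncard_eq_one]
  refine ⟨[], Set.Subset.antisymm ?_ ?_⟩
  · rintro v ⟨h, _⟩
    simpa using h
  · rintro v rfl
    exact ⟨rfl, 0, by simp⟩

/-- increment two inside the m-th interval -/
theorem rho_two {n m : ℕ} (h1 : 2 * KS (m + 1) < n) (h2 : n + KS m ≤ 3 * KS (m + 1)) :
    (KFS (n + 1)).ncard = (KFS n).ncard + 2 := by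
  have a3 := (Kw_length m).1
  have a4 := (Ku_length m).1
  rw [ncard_succ, KLSn_two (m := m) (by omega) (by omega)]

/-- increment one outside -/
theorem rho_one {n m : ℕ} (h1 : 3 * KS (m + 1) < n + KS m) (h2 : n ≤ 2 * KS (m + 2)) :
    (KFS (n + 1)).ncard = (KFS n).ncard + 1 := by
  rw [ncard_succ, KLSn_one]
  intro p hp
  have a1 := (Kw_length p).1
  have a2 := (Ku_length p).1
  rcases lt_or_ge m p with h | h
  · have := KS_mono (show m + 2 ≤ p + 1 by omega)
    omega
  · exfalso
    rcases h.eq_or_lt with rfl | h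
    · omega
    · have b1 := KS_mono (show p + 2 ≤ m + 1 by omega)
      have b2 := KS_lt m
      simp only [KS] at b1
      omega

theorem rho_small {n : ℕ} (h : n ≤ 2) : (KFS (n + 1)).ncard = (KFS n).ncard + 1 := by
  rw [ncard_succ, KLSn_one]
  intro p hp
  have a1 := (Kw_length p).1
  have := KS_mono (show 1 ≤ p + 1 by omega)
  simp only [KS] at this
  omega

theorem rho_up (m : ℕ) (h : (KFS (2 * KS (m + 1) + 1)).ncard = 2 * KS (m + 1) + 2 + KS m) :
    ∀ j, j + KS m ≤ KS (m + 1) →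
      (KFS (2 * KS (m + 1) + 1 + j)).ncard = 2 * KS (m + 1) + 2 + KS m + 2 * j := by
  intro j
  induction j with
  | zero => intro _; simpa using h
  | succ j ih =>
    intro hj
    have := rho_two (n := 2 * KS (m + 1) + 1 + j) (m := m) (by omega) (by omega)
    rw [← add_assoc, this, ih (by omega)]; omega

theorem rho_flat (m d : ℕ) (hd : d + KS m = KS (m + 1))
    (h : (KFS (2 * KS (m + 1) + 1 + d)).ncard = 2 * KS (m + 1) + 2 + KS m + 2 * d) :
    ∀ j, 2 * KS (m + 1) + 1 + d + j ≤ 2 * KS (m + 2) + 1 →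
      (KFS (2 * KS (m + 1) + 1 + d + j)).ncard = 2 * KS (m + 1) + 2 + KS m + 2 * d + j := by
  intro j
  induction j with
  | zero => intro _; simpa using h
  | succ j ih =>
    intro hj
    have := rho_one (n := 2 * KS (m + 1) + 1 + d + j) (m := m) (by omega) (by omega)
    rw [← add_assoc, this, ih (by omega)]; omega

theorem rho_start (m : ℕ) : (KFS (2 * KS (m + 1) + 1)).ncard = 2 * KS (m + 1) + 2 + KS m := by
  induction m with
  | zero =>
    have h0 := rho_zero
    have h1 := rho_small (n := 0) (by omega)
    have h2 := rho_small (n := 1) (by omega)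
    have h3 := rho_small (n := 2) (by omega)
    change (KFS (2 + 1)).ncard = 4
    rw [h3]
    change (KFS (1 + 1)).ncard + 1 = 4
    rw [h2, h1, h0]
  | succ m ih =>
    have hlt := KS_lt m
    obtain ⟨d, hd⟩ : ∃ d, d + KS m = KS (m + 1) := ⟨KS (m + 1) - KS m, by omega⟩
    have h1 := rho_up m ih d (by omega)
    have e : KS (m + 2) = 2 * KS (m + 1) + 2 * KS m + 2 := rfl
    have h2 := rho_flat m d hd h1 (2 * KS (m + 2) - 2 * KS (m + 1) - d) (by omega)
    have e2 : 2 * KS (m + 1) + 1 + d + (2 * KS (m + 2) - 2 * KS (m + 1) - d)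
      = 2 * KS (m + 1 + 1) + 1 := by
      show _ = 2 * KS (m + 2) + 1
      omega
    rw [e2] at h2
    rw [h2]
    show _ = 2 * KS (m + 2) + 2 + KS (m + 1)
    omega

theorem rho_A (m n : ℕ) (h1 : 2 * KS (m + 1) + 1 ≤ n) (h2 : n + KS m ≤ 3 * KS (m + 1) + 1) :
    (KFS n).ncard + 2 * KS (m + 1) = 2 * n + KS m := by
  obtain ⟨j, rfl⟩ := Nat.exists_eq_add_of_le h1
  rw [rho_up m (rho_start m) j (by omega)]; omega

theorem rho_B (m n : ℕ) (h1 : 3 * KS (m + 1) + 1 ≤ n + KS m) (h2 : n ≤ 2 * KS (m + 2) + 1) :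
    (KFS n).ncard = n + 1 + KS (m + 1) := by
  have hlt := KS_lt m
  obtain ⟨d, hd⟩ : ∃ d, d + KS m = KS (m + 1) := ⟨KS (m + 1) - KS m, by omega⟩
  obtain ⟨j, rfl⟩ := Nat.exists_eq_add_of_le (show 2 * KS (m + 1) + 1 + d ≤ n by omega)
  rw [rho_flat m d hd (rho_up m (rho_start m) d (by omega)) j (by omega)]; omega

theorem exists_block (n : ℕ) (hn : 3 ≤ n) :
    ∃ m, 2 * KS (m + 1) + 1 ≤ n ∧ n ≤ 2 * KS (m + 2) + 1 := by
  have hex : ∃ p, n ≤ 2 * KS (p + 2) + 1 := ⟨n, by have := KS_ge (n + 2); omega⟩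
  classical
  refine ⟨Nat.find hex, ?_, Nat.find_spec hex⟩
  by_contra hc
  rcases h : Nat.find hex with _ | p
  · rw [h] at hc; simp only [KS] at hc; omega
  · rw [h] at hc
    have := Nat.find_min hex (m := p) (by omega)
    apply this
    have e : p + 1 + 1 = p + 2 := rfl
    rw [e] at hc
    omega

theorem KS_err (m : ℕ) : 0 ≤ (KS (m + 1) : ℝ) - (1 + Real.sqrt 3) * KS m ∧
    (KS (m + 1) : ℝ) - (1 + Real.sqrt 3) * KS m ≤ 2 := by
  have h3 : Real.sqrt 3 * Real.sqrt 3 = 3 := Real.mul_self_sqrt (by norm_num)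
  have hl : (1 : ℝ) ≤ Real.sqrt 3 := Real.le_sqrt_of_sq_le (by norm_num)
  have hu : Real.sqrt 3 ≤ 2 := by rw [Real.sqrt_le_left (by norm_num)]; norm_num
  induction m with
  | zero => simp [KS]
  | succ m ih =>
    have ee : (KS (m + 1 + 1) : ℝ) = 2 * KS (m + 1) + 2 * KS m + 2 := by
      have : KS (m + 1 + 1) = 2 * KS (m + 1) + 2 * KS m + 2 := rfl
      rw [this]; push_cast; ring
    rw [ee]
    generalize (KS (m + 1) : ℝ) = x at *
    generalize (KS m : ℝ) = y at *
    generalize Real.sqrt 3 = r at *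
    obtain ⟨e, rfl⟩ : ∃ e, x = e + (1 + r) * y := ⟨x - (1 + r) * y, by ring⟩
    have i0 : 0 ≤ e := by linarith [ih.1]
    have i2 : e ≤ 2 := by linarith [ih.2]
    have key : 2 * (e + (1 + r) * y) + 2 * y + 2 - (1 + r) * (e + (1 + r) * y)
        = 2 - (r - 1) * e := by linear_combination (-y) * h3
    rw [key]
    constructor
    · nlinarith
    · nlinarith

theorem bounds_real (r S S' n R : ℝ) (h3 : r * r = 3) (hl : 17 / 10 ≤ r) (hu : r ≤ 18 / 10)
    (he0 : 0 ≤ S' - (1 + r) * S) (he2 : S' - (1 + r) * S ≤ 2)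
    (h : (2 * S' + 1 ≤ n ∧ n + S ≤ 3 * S' + 1 ∧ R + 2 * S' = 2 * n + S) ∨
      (3 * S' + 1 ≤ n + S ∧ n ≤ 2 * (2 * S' + 2 * S + 2) + 1 ∧ R = n + 1 + S')) :
    R ≤ (30 + r) / 23 * n + 10 ∧ (3 + r) / 4 * n - 10 ≤ R := by
  obtain ⟨e, rfl⟩ : ∃ e, S' = e + (1 + r) * S := ⟨S' - (1 + r) * S, by ring⟩
  have i0 : 0 ≤ e := by linarith
  have i2 : e ≤ 2 := by linarith
  have j0 : 0 ≤ r * e := by positivity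
  have j2 : r * e ≤ 4 := by nlinarith
  have h3S : r * r * S = 3 * S := by rw [h3]
  rcases h with ⟨h1, h2, hR⟩ | ⟨h1, h2, hR⟩
  · have k1 := mul_nonneg (show 0 ≤ 16 - r by linarith) (sub_nonneg.2 h2)
    have k2 := mul_nonneg (show 0 ≤ 5 - r by linarith) (sub_nonneg.2 h1)
    constructor
    · nlinarith
    · nlinarith
  · have k1 := mul_nonneg (show 0 ≤ 7 + r by linarith) (sub_nonneg.2 h1)
    have k2 := mul_nonneg (show 0 ≤ r - 1 by linarith) (sub_nonneg.2 h2)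
    constructor
    · nlinarith
    · nlinarith

theorem attain_real (r S S' : ℝ) (h3 : r * r = 3) (hl : 17 / 10 ≤ r) (hu : r ≤ 18 / 10)
    (he0 : 0 ≤ S' - (1 + r) * S) (he2 : S' - (1 + r) * S ≤ 2) :
    (30 + r) / 23 * (3 * S' - S + 1) - 10 ≤ (3 * S' - S + 1) + 1 + S' ∧
    2 * S' + 2 + S ≤ (3 + r) / 4 * (2 * S' + 1) + 10 := by
  obtain ⟨e, rfl⟩ : ∃ e, S' = e + (1 + r) * S := ⟨S' - (1 + r) * S, by ring⟩
  have i0 : 0 ≤ e := by linarith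
  have i2 : e ≤ 2 := by linarith
  have j0 : 0 ≤ r * e := by positivity
  have j2 : r * e ≤ 4 := by nlinarith
  have h3S : r * r * S = 3 * S := by rw [h3]
  constructor
  · nlinarith
  · nlinarith

theorem limsup_aux (u : ℕ → ℝ) (A B C : ℝ) (_ : 0 < C)
    (hup : ∀ n : ℕ, 3 ≤ n → u n ≤ A * n + C) (hlo : ∀ n : ℕ, 3 ≤ n → B * n - C ≤ u n)
    (hA : ∀ N : ℕ, ∃ n : ℕ, N ≤ n ∧ A * (n : ℝ) - C ≤ u n)
    (hB : ∀ N : ℕ, ∃ n : ℕ, N ≤ n ∧ u n ≤ B * (n : ℝ) + C) :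
    Filter.limsup (fun n : ℕ => u n / (n : ℝ)) Filter.atTop = A ∧
    Filter.liminf (fun n : ℕ => u n / (n : ℝ)) Filter.atTop = B := by
  have large : ∀ ε > 0, ∃ N : ℕ, 3 ≤ N ∧ ∀ n, N ≤ n → 0 < (n : ℝ) ∧ C ≤ ε * (n : ℝ) := by
    intro ε hε
    obtain ⟨N, hN⟩ := exists_nat_ge (C / ε)
    refine ⟨max N 3, le_max_right _ _, fun n hn => ?_⟩
    have h1 : N ≤ n := le_trans (le_max_left _ _) hn
    have h2 : 3 ≤ n := le_trans (le_max_right _ _) hn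
    refine ⟨by positivity, ?_⟩
    have h4 : (N : ℝ) ≤ n := by exact_mod_cast h1
    rw [div_le_iff₀ hε] at hN
    nlinarith
  have up : ∀ ε > 0, ∀ᶠ n : ℕ in atTop, u n / (n : ℝ) ≤ A + ε := by
    intro ε hε
    obtain ⟨N, hN3, hN⟩ := large ε hε
    filter_upwards [eventually_ge_atTop N] with n hn
    obtain ⟨p, q⟩ := hN n hn
    rw [div_le_iff₀ p]
    linarith [hup n (by omega)]
  have lo : ∀ ε > 0, ∀ᶠ n : ℕ in atTop, B - ε ≤ u n / (n : ℝ) := by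
    intro ε hε
    obtain ⟨N, hN3, hN⟩ := large ε hε
    filter_upwards [eventually_ge_atTop N] with n hn
    obtain ⟨p, q⟩ := hN n hn
    rw [le_div_iff₀ p]
    linarith [hlo n (by omega)]
  have fA : ∀ ε > 0, ∃ᶠ n : ℕ in atTop, A - ε ≤ u n / (n : ℝ) := by
    intro ε hε
    rw [frequently_atTop]
    intro M
    obtain ⟨N, hN3, hN⟩ := large ε hε
    obtain ⟨n, hn, h⟩ := hA (max M N)
    obtain ⟨p, q⟩ := hN n (le_trans (le_max_right _ _) hn)
    refine ⟨n, le_trans (le_max_left _ _) hn, ?_⟩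
    rw [le_div_iff₀ p]
    linarith
  have fB : ∀ ε > 0, ∃ᶠ n : ℕ in atTop, u n / (n : ℝ) ≤ B + ε := by
    intro ε hε
    rw [frequently_atTop]
    intro M
    obtain ⟨N, hN3, hN⟩ := large ε hε
    obtain ⟨n, hn, h⟩ := hB (max M N)
    obtain ⟨p, q⟩ := hN n (le_trans (le_max_right _ _) hn)
    refine ⟨n, le_trans (le_max_left _ _) hn, ?_⟩
    rw [div_le_iff₀ p]
    linarith
  have bU : IsBoundedUnder (· ≤ ·) atTop (fun n : ℕ => u n / (n : ℝ)) :=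
    isBoundedUnder_of_eventually_le (up 1 one_pos)
  have bL : IsBoundedUnder (· ≥ ·) atTop (fun n : ℕ => u n / (n : ℝ)) :=
    isBoundedUnder_of_eventually_ge (lo 1 one_pos)
  constructor
  · apply le_antisymm
    · apply le_of_forall_pos_le_add
      intro ε hε
      exact limsup_le_of_le bL.isCoboundedUnder_le (up ε hε)
    · apply le_of_forall_pos_le_add
      intro ε hε
      have := le_limsup_of_frequently_le (fA ε hε) bU
      linarith
  · apply le_antisymm
    · apply le_of_forall_pos_le_add
      intro ε hε
      exact liminf_le_of_frequently_le (fB ε hε) bL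
    · apply le_of_forall_pos_le_add
      intro ε hε
      have := le_liminf_of_le bU.isCoboundedUnder_ge (lo ε hε)
      linarith

/-- For the fixed point `k` of `h`: `limsup ρ(n)/n = (30 + √3)/23` and
`liminf ρ(n)/n = (3 + √3)/4`. -/
theorem complexity_limsup_liminf
    (k : ℕ → ℕ)
    (hk : ∀ (m i : ℕ), i < (Kword m).length → k (i + 1) = (Kword m).getD i 0) :
    Filter.limsup (fun n : ℕ => (complexity k n : ℝ) / (n : ℝ)) Filter.atTop
        = (30 + Real.sqrt 3) / 23 ∧
    Filter.liminf (fun n : ℕ => (complexity k n : ℝ) / (n : ℝ)) Filter.atTop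
        = (3 + Real.sqrt 3) / 4 := by
  have hc : ∀ n, complexity k n = (KFS n).ncard := by
    intro n
    unfold complexity KFS
    congr 1
    ext w
    exact and_congr_right fun _ => isFactor_iff k hk w
  have h3 : Real.sqrt 3 * Real.sqrt 3 = 3 := Real.mul_self_sqrt (by norm_num)
  have hl : (17 / 10 : ℝ) ≤ Real.sqrt 3 := Real.le_sqrt_of_sq_le (by norm_num)
  have hu : Real.sqrt 3 ≤ 18 / 10 := by rw [Real.sqrt_le_left (by norm_num)]; norm_num
  have bd : ∀ n : ℕ, 3 ≤ n → ((complexity k n : ℝ) ≤ (30 + Real.sqrt 3) / 23 * n + 10 ∧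
      (3 + Real.sqrt 3) / 4 * n - 10 ≤ (complexity k n : ℝ)) := by
    intro n hn
    obtain ⟨m, h1, h2⟩ := exists_block n hn
    obtain ⟨e0, e2⟩ := KS_err m
    refine bounds_real _ (KS m) (KS (m + 1)) n _ h3 hl hu e0 e2 ?_
    rw [hc]
    rcases le_total (n + KS m) (3 * KS (m + 1) + 1) with h | h
    · left
      have := rho_A m n h1 h
      exact ⟨by exact_mod_cast h1, by exact_mod_cast h, by exact_mod_cast this⟩
    · right
      have := rho_B m n h h2
      have e : KS (m + 2) = 2 * KS (m + 1) + 2 * KS m + 2 := rfl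
      rw [e] at h2
      exact ⟨by exact_mod_cast h, by exact_mod_cast h2, by exact_mod_cast this⟩
  apply limsup_aux (fun n => (complexity k n : ℝ)) _ _ 10 (by norm_num)
    (fun n hn => (bd n hn).1) (fun n hn => (bd n hn).2)
  · intro N
    obtain ⟨e0, e2⟩ := KS_err N
    have at1 := (attain_real _ (KS N) (KS (N + 1)) h3 hl hu e0 e2).1
    have hlt := KS_lt N
    have hge := KS_ge N
    obtain ⟨n, hn⟩ : ∃ n, n + KS N = 3 * KS (N + 1) + 1 := ⟨3 * KS (N + 1) + 1 - KS N, by omega⟩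
    have e : KS (N + 2) = 2 * KS (N + 1) + 2 * KS N + 2 := rfl
    have hr := rho_B N n (by omega) (by omega)
    have hn' : (n : ℝ) = 3 * KS (N + 1) - KS N + 1 := by
      have : (n : ℝ) + KS N = 3 * KS (N + 1) + 1 := by exact_mod_cast hn
      linarith
    refine ⟨n, by omega, ?_⟩
    rw [hc, hr]
    push_cast
    rw [hn']
    exact at1
  · intro N
    obtain ⟨e0, e2⟩ := KS_err N
    have at1 := (attain_real _ (KS N) (KS (N + 1)) h3 hl hu e0 e2).2
    have hlt := KS_lt N
    have hge := KS_ge N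
    refine ⟨2 * KS (N + 1) + 1, by omega, ?_⟩
    rw [hc, rho_start N]
    push_cast
    exact at1
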